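/- arXiv:2406.19114 — 2 statements merged into one kernel-verified Lean document; each statement's English description precedes it below -/
import Mathlib

section
/- Let μ be a Borel probability measure on ℂ supported on the unit circle ∂𝔻, let z ∈ ∂𝔻, and let (r_j)_{j≥1} be a sequence of positive reals tending to 0 such that μ(D(z, r_j))/r_j → ∞ as j → ∞. Then there exist a sequence (β_j)_{j≥1} of positive reals tending to ∞ and a sequence (F_j)_{j≥1} of real-valued functions on the closed unit disc, each continuous on the closed unit disc and harmonic on 𝔻, such that β_j r_j → 0 and, for all sufficiently large j, F_j < 0 everywhere on (closed 𝔻) \ D(z, β_j r_j) while ∫_{∂𝔻} F_j dμ > 0. -/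
open Metric MeasureTheory Filter

/-- The Laplacian `∂²f/∂x² + ∂²f/∂y²` of a function `f : ℂ → ℝ`, expressed via
iterated Fréchet derivatives in the directions `1` and `I`. -/
noncomputable def planeLaplacian (f : ℂ → ℝ) (z : ℂ) : ℝ :=
  fderiv ℝ (fun w => fderiv ℝ f w 1) z 1
    + fderiv ℝ (fun w => fderiv ℝ f w Complex.I) z Complex.I

/-- `f` is harmonic on an open set `V ⊆ ℂ`: twice continuously differentiable with
vanishing Laplacian on `V`. -/
def HarmonicOnSet (f : ℂ → ℝ) (V : Set ℂ) : Prop :=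
  ContDiffOn ℝ 2 f V ∧ ∀ z ∈ V, planeLaplacian f z = 0

open Laplacian in
lemma planeLaplacian_eq_laplacian {f : ℂ → ℝ} {z : ℂ} (hf : ContDiffAt ℝ 2 f z) :
    planeLaplacian f z = Δ f z := by
  have hd : DifferentiableAt ℝ (fderiv ℝ f) z :=
    (hf.fderiv_right (m := 1) (by norm_num)).differentiableAt (by norm_num)
  have happly : ∀ v : ℂ,
      fderiv ℝ (fun w => fderiv ℝ f w v) z v = fderiv ℝ (fderiv ℝ f) z v v := by
    intro v
    rw [fderiv_clm_apply hd (differentiableAt_const v)]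
    simp
  rw [planeLaplacian, happly, happly, InnerProductSpace.laplacian_eq_iteratedFDeriv_complexPlane]
  simp [iteratedFDeriv_two_apply]

lemma harmonicOnSet_of_harmonicAt {f : ℂ → ℝ} {V : Set ℂ}
    (h : ∀ w ∈ V, InnerProductSpace.HarmonicAt f w) : HarmonicOnSet f V :=
  ⟨fun w hw => (h w hw).1.contDiffWithinAt, fun w hw => by
    rw [planeLaplacian_eq_laplacian (h w hw).1]
    exact (h w hw).2.eq_of_nhds⟩

/-- The real part of the Cauchy-type kernel with pole `(1 + r) z`, which lies outside the closed
unit disc when `‖z‖ = 1` and `0 < r`. -/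
noncomputable def outerKernel (z : ℂ) (r : ℝ) (w : ℂ) : ℝ :=
  (z / ((1 + r) * z - w)).re

section outerKernel

variable {z w : ℂ} {r : ℝ}

lemma le_re_mul_conj (hz : ‖z‖ = 1) (hw : ‖w‖ ≤ 1) :
    r ≤ (z * (starRingEnd ℂ) ((1 + r) * z - w)).re := by
  have h1 : z * (starRingEnd ℂ) ((1 + r) * z - w)
      = (1 + r : ℝ) * (z * (starRingEnd ℂ) z) - z * (starRingEnd ℂ) w := by
    simp only [map_sub, map_mul, map_add, map_one, Complex.conj_ofReal]
    push_cast
    ring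
  have h2 : (z * (starRingEnd ℂ) w).re ≤ 1 := by
    refine (Complex.re_le_norm _).trans ?_
    rw [norm_mul, Complex.norm_conj, hz, one_mul]
    exact hw
  rw [h1, Complex.mul_conj, Complex.normSq_eq_norm_sq, hz, Complex.sub_re]
  simp only [one_pow, Complex.ofReal_one, mul_one, Complex.ofReal_re]
  linarith

lemma outerKernel_eq (z : ℂ) (r : ℝ) (w : ℂ) :
    outerKernel z r w = (z * (starRingEnd ℂ) ((1 + r) * z - w)).re / ‖(1 + r) * z - w‖ ^ 2 := by
  rw [outerKernel, div_eq_mul_inv, Complex.inv_def, ← mul_assoc, Complex.re_mul_ofReal,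
    Complex.normSq_eq_norm_sq, div_eq_mul_inv]

lemma pole_sub_ne_zero (hr : 0 < r) (hz : ‖z‖ = 1) (hw : ‖w‖ ≤ 1) : (1 + r) * z - w ≠ 0 := by
  intro h
  have := le_re_mul_conj (r := r) hz hw
  rw [h] at this
  simp only [map_zero, mul_zero, Complex.zero_re] at this
  linarith

lemma outerKernel_nonneg (hr : 0 < r) (hz : ‖z‖ = 1) (hw : ‖w‖ ≤ 1) :
    0 ≤ outerKernel z r w := by
  rw [outerKernel_eq]
  have := le_re_mul_conj (r := r) hz hw
  exact div_nonneg (by linarith) (by positivity)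

lemma norm_pole_sub (hr : 0 < r) (hz : ‖z‖ = 1) : ‖(1 + r) * z - z‖ = r := by
  rw [show (1 + r) * z - z = r * z by ring, norm_mul, hz, mul_one, Complex.norm_real,
    Real.norm_of_nonneg hr.le]

lemma le_outerKernel (hr : 0 < r) (hz : ‖z‖ = 1) (hw : ‖w‖ ≤ 1) (hwz : w ∈ ball z r) :
    1 / (4 * r) ≤ outerKernel z r w := by
  have h1 := le_re_mul_conj (r := r) hz hw
  have h2 : 0 < ‖(1 + r) * z - w‖ := norm_pos_iff.2 (pole_sub_ne_zero hr hz hw)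
  have h3 : ‖(1 + r) * z - w‖ ≤ 2 * r := by
    have := norm_sub_le_norm_sub_add_norm_sub ((1 + r) * z) z w
    rw [norm_pole_sub hr hz] at this
    rw [mem_ball', dist_eq_norm] at hwz
    linarith
  rw [outerKernel_eq, div_le_div_iff₀ (by positivity) (by positivity)]
  nlinarith

lemma outerKernel_lt (hr : 0 < r) (hz : ‖z‖ = 1) {s : ℝ} (hs : 2 * r < s) (hwz : w ∉ ball z s) :
    outerKernel z r w < 2 / s := by
  have h1 : s / 2 < ‖(1 + r) * z - w‖ := by
    have := norm_sub_le_norm_sub_add_norm_sub z ((1 + r) * z) w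
    rw [norm_sub_rev z ((1 + r) * z), norm_pole_sub hr hz] at this
    rw [mem_ball', dist_eq_norm, not_lt] at hwz
    linarith
  have h2 : 0 < s := by linarith
  refine (Complex.re_le_norm _).trans_lt ?_
  rw [norm_div, hz, div_lt_div_iff₀ (by linarith) h2]
  linarith

lemma harmonicAt_outerKernel (hr : 0 < r) (hz : ‖z‖ = 1) (hw : ‖w‖ ≤ 1) :
    InnerProductSpace.HarmonicAt (outerKernel z r) w := by
  have h : AnalyticAt ℂ (fun w => z / ((1 + r) * z - w)) w :=
    analyticAt_const.div (analyticAt_const.sub analyticAt_id) (pole_sub_ne_zero hr hz hw)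
  exact h.harmonicAt_re

lemma le_integral_outerKernel_sub (hr : 0 < r) (hz : ‖z‖ = 1) (c : ℝ) (μ : Measure ℂ)
    [IsProbabilityMeasure μ] (hsupp : μ ((sphere (0:ℂ) 1)ᶜ) = 0) :
    μ.real (ball z r) / (4 * r) - c ≤ ∫ w, (outerKernel z r w - c) ∂μ := by
  have hae : ∀ᵐ w ∂μ, ‖w‖ ≤ 1 := by
    have : ∀ᵐ w ∂μ, w ∈ sphere (0:ℂ) 1 := hsupp
    filter_upwards [this] with w hw
    exact (mem_sphere_zero_iff_norm.1 hw).le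
  have hint : Integrable (outerKernel z r) μ := by
    have hc : ContinuousOn (outerKernel z r) (closedBall 0 1) := fun w hw =>
      (harmonicAt_outerKernel hr hz
        (mem_closedBall_zero_iff.1 hw)).1.continuousAt.continuousWithinAt
    have := hc.integrableOn_compact (μ := μ) (isCompact_closedBall 0 1)
    rwa [IntegrableOn, Measure.restrict_eq_self_of_ae_mem] at this
    filter_upwards [hae] with w hw using mem_closedBall_zero_iff.2 hw
  rw [integral_sub hint (integrable_const c)]
  simp only [integral_const, probReal_univ, one_smul]
  gcongr
  calc μ.real (ball z r) / (4 * r)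
      = ∫ w, (ball z r).indicator (fun _ => 1 / (4 * r)) w ∂μ := by
        rw [integral_indicator_const _ measurableSet_ball, smul_eq_mul, mul_one_div]
    _ ≤ ∫ w, outerKernel z r w ∂μ := by
        refine integral_mono_ae ((integrable_const _).indicator measurableSet_ball) hint ?_
        filter_upwards [hae] with w hw
        by_cases hwz : w ∈ ball z r
        · simpa only [Set.indicator_of_mem hwz] using le_outerKernel hr hz hw hwz
        · simpa only [Set.indicator_of_notMem hwz] using outerKernel_nonneg hr hz hw

end outerKernel

/-- If `m ≤ 1`, `0 < r` and `m / r → ∞`, there is an intermediate scale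
`s` with `s → 0`, `s / r → ∞` and `s m / r → ∞`. -/
lemma exists_intermediate_scale {m r : ℕ → ℝ} (hm : ∀ j, m j ≤ 1) (hrpos : ∀ j, 0 < r j)
    (hblow : Tendsto (fun j => m j / r j) atTop atTop) :
    ∃ s : ℕ → ℝ, (∀ j, 0 < s j) ∧ Tendsto s atTop (nhds 0) ∧
      Tendsto (fun j => s j / r j) atTop atTop ∧
      Tendsto (fun j => m j / r j * s j) atTop atTop := by
  set M : ℕ → ℝ := fun j => max (m j / r j) 1
  have hMpos : ∀ j, 0 < M j := fun j => lt_max_of_lt_right one_pos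
  have hMev : ∀ᶠ j in atTop, M j = m j / r j := by
    filter_upwards [hblow.eventually_ge_atTop 1] with j hj using max_eq_left hj
  have hsqrt : Tendsto (fun j => √(M j)) atTop atTop :=
    Real.tendsto_sqrt_atTop.comp (hblow.congr' (hMev.mono fun _ h => h.symm))
  have hspos : ∀ j, 0 < (√(M j))⁻¹ := fun j => inv_pos.2 (Real.sqrt_pos.2 (hMpos j))
  have hmul : Tendsto (fun j => m j / r j * (√(M j))⁻¹) atTop atTop := by
    refine hsqrt.congr' ?_
    filter_upwards [hMev] with j hj
    rw [← hj, ← div_eq_mul_inv, Real.div_sqrt]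
  refine ⟨fun j => (√(M j))⁻¹, hspos, tendsto_inv_atTop_zero.comp hsqrt, ?_, hmul⟩
  refine tendsto_atTop_mono (fun j => ?_) hmul
  rw [div_mul_eq_mul_div]
  have := hrpos j
  gcongr
  exact mul_le_of_le_one_left (hspos j).le (hm j)

/-- Paper's Lemma 3.1: given a probability measure `μ` on the unit circle, a point
`z` on the circle, and radii `r_j → 0` with `μ(D(z,r_j))/r_j → ∞`, there are
`β_j → ∞` with `β_j r_j → 0` and functions `F_j`, continuous on the closed disc and
harmonic on the open disc, such that eventually `F_j < 0` off `D(z, β_j r_j)` while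
`∫ F_j dμ > 0`. -/
theorem harmonic_construction_on_disc
    (μ : Measure ℂ) [IsProbabilityMeasure μ]
    (hsupp : μ ((sphere (0:ℂ) 1)ᶜ) = 0)
    (z : ℂ) (hz : z ∈ sphere (0:ℂ) 1)
    (r : ℕ → ℝ) (hrpos : ∀ j, 0 < r j)
    (hr0 : Tendsto r atTop (nhds 0))
    (hblow : Tendsto (fun j => (μ (ball z (r j))).toReal / r j) atTop atTop) :
    ∃ (β : ℕ → ℝ) (F : ℕ → ℂ → ℝ),
      (∀ j, 0 < β j) ∧
      Tendsto β atTop atTop ∧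
      Tendsto (fun j => β j * r j) atTop (nhds 0) ∧
      (∀ j, ContinuousOn (F j) (closedBall (0:ℂ) 1)) ∧
      (∀ j, HarmonicOnSet (F j) (ball (0:ℂ) 1)) ∧
      ∀ᶠ j in atTop,
        (∀ w ∈ closedBall (0:ℂ) 1 \ ball z (β j * r j), F j w < 0) ∧
        0 < ∫ w, F j w ∂μ := by
  have hz1 : ‖z‖ = 1 := mem_sphere_zero_iff_norm.1 hz
  obtain ⟨s, hspos, hs0, hsr, hms⟩ := exists_intermediate_scale
    (m := fun j => μ.real (ball z (r j))) (fun j => measureReal_le_one) hrpos hblow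
  have hsmul : ∀ j, s j / r j * r j = s j := fun j => div_mul_cancel₀ _ (hrpos j).ne'
  have hharm : ∀ j, ∀ w : ℂ, ‖w‖ ≤ 1 →
      InnerProductSpace.HarmonicAt (fun w => outerKernel z (r j) w - 2 / s j) w := fun j w hw =>
    (harmonicAt_outerKernel (hrpos j) hz1 hw).sub (InnerProductSpace.harmonicAt_const _)
  refine ⟨fun j => s j / r j, fun j w => outerKernel z (r j) w - 2 / s j,
    fun j => div_pos (hspos j) (hrpos j), hsr, by simpa only [hsmul] using hs0,
    fun j w hw => (hharm j w (mem_closedBall_zero_iff.1 hw)).1.continuousAt.continuousWithinAt,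
    fun j => harmonicOnSet_of_harmonicAt fun w hw => hharm j w (mem_ball_zero_iff.1 hw).le, ?_⟩
  filter_upwards [hsr.eventually_gt_atTop 2, hms.eventually_gt_atTop 8] with j h2 h8
  constructor
  · rintro w ⟨-, hw⟩
    rw [hsmul] at hw
    exact sub_neg.2 (outerKernel_lt (hrpos j) hz1 ((lt_div_iff₀ (hrpos j)).1 h2) hw)
  · refine lt_of_lt_of_le ?_ (le_integral_outerKernel_sub (hrpos j) hz1 (2 / s j) μ hsupp)
    rw [sub_pos, div_lt_iff₀ (hspos j), mul_comm 4, ← div_div]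
    linarith
end

section
/- There exists a constant κ > 0 (one may take κ = π/8) with the following property: for every R > 0, every c₀ > 0, and every function u : ℂ → ℝ that is twice continuously differentiable on an open neighborhood of the closed disc {z : |z| ≤ R}, if u ≤ 0 on this closed disc and Δu(z) ≤ −c₀ for every z in this closed disc, then ∫_{D(0,R)} (−u) dA ≥ κ · c₀ · R⁴, where dA denotes two-dimensional Lebesgue measure. -/
open Metric MeasureTheory Real

/-- The product of a function continuous on a set with a continuous function compactly supported
in that set is integrable. -/
lemma integrable_mul_of_continuousOn_of_tsupport_subset {f g : ℂ → ℝ} {V : Set ℂ}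
    (hf : ContinuousOn f V) (hg : Continuous g) (hgc : HasCompactSupport g)
    (hgV : tsupport g ⊆ V) : Integrable (fun z => f z * g z) := by
  rw [← integrableOn_iff_integrable_of_support_subset (s := tsupport g)]
  · exact ((hf.mono hgV).mul hg.continuousOn).integrableOn_compact hgc.isCompact
  · intro z hz
    exact subset_tsupport _ (right_ne_zero_of_mul hz)

lemma ContDiffOn.fderiv_apply_const {f : ℂ → ℝ} {V : Set ℂ} {m n : WithTop ℕ∞} (hV : IsOpen V)
    (hf : ContDiffOn ℝ n f V) (hmn : m + 1 ≤ n) (v : ℂ) :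
    ContDiffOn ℝ m (fun z => fderiv ℝ f z v) V :=
  (hf.fderiv_of_isOpen hV hmn).clm_apply contDiffOn_const

lemma ContDiff.fderiv_apply_const {f : ℂ → ℝ} {m n : WithTop ℕ∞}
    (hf : ContDiff ℝ n f) (hmn : m + 1 ≤ n) (v : ℂ) :
    ContDiff ℝ m (fun z => fderiv ℝ f z v) :=
  (hf.fderiv_right hmn).clm_apply contDiff_const

lemma integral_mul_fderiv_eq_neg {f g : ℂ → ℝ} {V : Set ℂ} (hV : IsOpen V)
    (hf : ContDiffOn ℝ 1 f V) (hg : ContDiff ℝ 1 g) (hgc : HasCompactSupport g)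
    (hgV : tsupport g ⊆ V) (v : ℂ) :
    ∫ z, f z * fderiv ℝ g z v = -∫ z, fderiv ℝ f z v * g z := by
  have hd : Continuous (fun z => fderiv ℝ g z v) :=
    (hg.fderiv_apply_const (m := 0) (by norm_num) v).continuous
  refine integral_mul_fderiv_eq_neg_fderiv_mul_of_integrable ?_ ?_ ?_ ?_ ?_
  · exact integrable_mul_of_continuousOn_of_tsupport_subset
      (hf.fderiv_apply_const hV (m := 0) (by norm_num) v).continuousOn hg.continuous hgc hgV
  · exact integrable_mul_of_continuousOn_of_tsupport_subset hf.continuousOn hd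
      (hgc.fderiv_apply ℝ v) ((tsupport_fderiv_apply_subset ℝ v).trans hgV)
  · exact integrable_mul_of_continuousOn_of_tsupport_subset hf.continuousOn hg.continuous hgc hgV
  · intro z hz
    exact (hf.contDiffAt (hV.mem_nhds (hgV hz))).differentiableAt one_ne_zero
  · intro z _
    exact hg.differentiable one_ne_zero z

lemma integral_mul_fderiv_fderiv_eq {f g : ℂ → ℝ} {V : Set ℂ} (hV : IsOpen V)
    (hf : ContDiffOn ℝ 2 f V) (hg : ContDiff ℝ 2 g) (hgc : HasCompactSupport g)
    (hgV : tsupport g ⊆ V) (v : ℂ) :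
    ∫ z, f z * fderiv ℝ (fun w => fderiv ℝ g w v) z v
      = ∫ z, fderiv ℝ (fun w => fderiv ℝ f w v) z v * g z := by
  rw [integral_mul_fderiv_eq_neg hV (hf.of_le one_le_two)
      (hg.fderiv_apply_const (m := 1) (by norm_num) v) (hgc.fderiv_apply ℝ v)
      ((tsupport_fderiv_apply_subset ℝ v).trans hgV) v,
    integral_mul_fderiv_eq_neg hV (hf.fderiv_apply_const hV (m := 1) (by norm_num) v)
      (hg.of_le one_le_two) hgc hgV v, neg_neg]

lemma ContDiffOn.continuousOn_fderiv_fderiv {f : ℂ → ℝ} {V : Set ℂ} (hV : IsOpen V)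
    (hf : ContDiffOn ℝ 2 f V) (v : ℂ) :
    ContinuousOn (fun z => fderiv ℝ (fun w => fderiv ℝ f w v) z v) V :=
  ((hf.fderiv_apply_const hV (m := 1) (by norm_num) v).fderiv_apply_const hV
    (m := 0) (by norm_num) v).continuousOn

lemma ContDiffOn.continuousOn_planeLaplacian {f : ℂ → ℝ} {V : Set ℂ} (hV : IsOpen V)
    (hf : ContDiffOn ℝ 2 f V) : ContinuousOn (planeLaplacian f) V :=
  (hf.continuousOn_fderiv_fderiv hV 1).add (hf.continuousOn_fderiv_fderiv hV Complex.I)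

lemma tsupport_fderiv_fderiv_subset (g : ℂ → ℝ) (v : ℂ) :
    tsupport (fun z => fderiv ℝ (fun w => fderiv ℝ g w v) z v) ⊆ tsupport g :=
  (tsupport_fderiv_apply_subset ℝ v).trans (tsupport_fderiv_apply_subset ℝ v)

lemma tsupport_planeLaplacian_subset (g : ℂ → ℝ) : tsupport (planeLaplacian g) ⊆ tsupport g :=
  (tsupport_add _ _).trans <|
    Set.union_subset (tsupport_fderiv_fderiv_subset g 1) (tsupport_fderiv_fderiv_subset g Complex.I)

/-- Green's identity against a compactly supported test function. -/
lemma integral_mul_planeLaplacian {f g : ℂ → ℝ} {V : Set ℂ} (hV : IsOpen V)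
    (hf : ContDiffOn ℝ 2 f V) (hg : ContDiff ℝ 2 g) (hgc : HasCompactSupport g)
    (hgV : tsupport g ⊆ V) :
    ∫ z, f z * planeLaplacian g z = ∫ z, planeLaplacian f z * g z := by
  have hright (v : ℂ) :
      Integrable (fun z => f z * fderiv ℝ (fun w => fderiv ℝ g w v) z v) :=
    integrable_mul_of_continuousOn_of_tsupport_subset hf.continuousOn
      (continuousOn_univ.1 (hg.contDiffOn.continuousOn_fderiv_fderiv isOpen_univ v))
      ((hgc.fderiv_apply ℝ v).fderiv_apply ℝ v)
      ((tsupport_fderiv_fderiv_subset g v).trans hgV)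
  have hleft (v : ℂ) :
      Integrable (fun z => fderiv ℝ (fun w => fderiv ℝ f w v) z v * g z) :=
    integrable_mul_of_continuousOn_of_tsupport_subset (hf.continuousOn_fderiv_fderiv hV v)
      hg.continuous hgc hgV
  simp only [planeLaplacian, mul_add, add_mul]
  rw [integral_add (hright _) (hright _), integral_add (hleft _) (hleft _),
    integral_mul_fderiv_fderiv_eq hV hf hg hgc hgV, integral_mul_fderiv_fderiv_eq hV hf hg hgc hgV]

lemma planeLaplacian_comp_smul {f : ℂ → ℝ} (hf : ContDiff ℝ 2 f) (c : ℝ) (z : ℂ) :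
    planeLaplacian (fun w => f (c • w)) z = c ^ 2 * planeLaplacian f (c • z) := by
  have key (v : ℂ) : fderiv ℝ (fun w => fderiv ℝ (fun w => f (c • w)) w v) z v
      = c ^ 2 * fderiv ℝ (fun w => fderiv ℝ f w v) (c • z) v := by
    have h1 : (fun w => fderiv ℝ (fun w => f (c • w)) w v)
        = fun w => c * (fun w => fderiv ℝ f w v) (c • w) := by
      ext w
      rw [fderiv_comp_smul (f := f)]
      simp
    have hd : DifferentiableAt ℝ (fun w => (fun w => fderiv ℝ f w v) (c • w)) z :=
      (((hf.fderiv_apply_const (m := 1) (by norm_num) v).differentiable one_ne_zero)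
        (c • z)).comp z (differentiableAt_id.const_smul c)
    rw [h1, fderiv_const_mul hd, fderiv_comp_smul (f := fun w => fderiv ℝ f w v)]
    simp only [FunLike.coe_smul, Pi.smul_apply, smul_eq_mul]
    ring
  simp only [planeLaplacian, key]
  ring

/-- Local quantitative estimate underlying the lower bound of the paper's
Proposition 9.1: there is `κ > 0` such that any `C²` function `u ≤ 0` on the closed
disc of radius `R` with `Δu ≤ -c₀` there satisfies `∫_{D(0,R)} (-u) dA ≥ κ c₀ R⁴`. -/
theorem neg_subharmonic_mass_lower_bound :
    ∃ κ > 0, ∀ (R c₀ : ℝ) (u : ℂ → ℝ), 0 < R → 0 < c₀ →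
      (∃ V : Set ℂ, IsOpen V ∧ closedBall (0:ℂ) R ⊆ V ∧ ContDiffOn ℝ 2 u V) →
      (∀ z ∈ closedBall (0:ℂ) R, u z ≤ 0) →
      (∀ z ∈ closedBall (0:ℂ) R, planeLaplacian u z ≤ -c₀) →
      κ * c₀ * R ^ 4 ≤ ∫ z in ball (0:ℂ) R, (-(u z)) := by
  let φ : ContDiffBump (0 : ℂ) := ⟨1 / 4, 1 / 2, by norm_num, by norm_num⟩
  have hφ : ContDiff ℝ 2 φ := φ.contDiff
  have hφL : Continuous (planeLaplacian φ) :=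
    continuousOn_univ.1 (hφ.contDiffOn.continuousOn_planeLaplacian isOpen_univ)
  have hφLc : HasCompactSupport (planeLaplacian φ) :=
    φ.hasCompactSupport.of_isClosed_subset (isClosed_tsupport _) (tsupport_planeLaplacian_subset φ)
  obtain ⟨M₀, hM₀⟩ := hφLc.exists_bound_of_continuous hφL
  obtain ⟨M, hMpos, hM⟩ : ∃ M > 0, ∀ z, planeLaplacian φ z ≤ M :=
    ⟨max M₀ 1, by positivity, fun z => (le_abs_self _).trans ((hM₀ z).trans (le_max_left _ _))⟩
  have hm : 0 < ∫ z, φ z := φ.integral_pos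
  refine ⟨(∫ z, φ z) / M, by positivity, ?_⟩
  rintro R c₀ u hR hc₀ ⟨V, hV, hRV, hu⟩ hu0 hΔ
  let g : ℂ → ℝ := fun z => φ (R⁻¹ • z)
  have hg : ContDiff ℝ 2 g := hφ.comp (contDiff_const_smul R⁻¹)
  have hgR : tsupport g ⊆ ball 0 R := by
    have : tsupport g ⊆ closedBall 0 (R / 2) := by
      refine closure_minimal (fun z hz => ?_) isClosed_closedBall
      by_contra hz'
      refine hz (φ.zero_of_le_dist ?_)
      rw [mem_closedBall_zero_iff, not_le] at hz'
      rw [dist_zero_right, norm_smul, norm_inv, Real.norm_of_nonneg hR.le, inv_mul_eq_div,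
        le_div_iff₀ hR]
      change 1 / 2 * R ≤ ‖z‖
      linarith
    exact this.trans (closedBall_subset_ball (by linarith))
  have hgc : HasCompactSupport g :=
    (isCompact_closedBall 0 R).of_isClosed_subset (isClosed_tsupport _)
      (hgR.trans ball_subset_closedBall)
  have hgV : tsupport g ⊆ V := hgR.trans (ball_subset_closedBall.trans hRV)
  have hgint : ∫ z, g z = R ^ 2 * ∫ z, φ z := by
    have := Measure.integral_comp_inv_smul_of_nonneg volume (fun z : ℂ => φ z) hR.le
    rwa [Complex.finrank_real_complex, smul_eq_mul] at this
  have hgL (z : ℂ) : planeLaplacian g z ≤ M / R ^ 2 := by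
    rw [planeLaplacian_comp_smul hφ, inv_pow, inv_mul_eq_div]
    gcongr
    exact hM _
  have hlower : c₀ * (R ^ 2 * ∫ z, φ z) ≤ -∫ z, planeLaplacian u z * g z := by
    rw [← hgint, ← integral_const_mul, ← integral_neg]
    refine integral_mono ((hg.continuous.integrable_of_hasCompactSupport hgc).const_mul _)
      (integrable_mul_of_continuousOn_of_tsupport_subset (hu.continuousOn_planeLaplacian hV)
        hg.continuous hgc hgV).neg fun z => ?_
    by_cases hz : z ∈ tsupport g
    · have h1 := hΔ z (ball_subset_closedBall (hgR hz))
      have h2 : 0 ≤ g z := φ.nonneg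
      change c₀ * g z ≤ -(planeLaplacian u z * g z)
      nlinarith
    · simp [image_eq_zero_of_notMem_tsupport hz]
  have hupper : -∫ z, u z * planeLaplacian g z ≤ M / R ^ 2 * ∫ z in ball (0 : ℂ) R, -(u z) := by
    rw [← integral_neg, ← setIntegral_eq_integral_of_forall_compl_eq_zero (s := ball (0 : ℂ) R),
      ← integral_const_mul]
    · refine setIntegral_mono_on ?_ ?_ measurableSet_ball fun z hz => ?_
      · exact (integrable_mul_of_continuousOn_of_tsupport_subset hu.continuousOn
          (continuousOn_univ.1 (hg.contDiffOn.continuousOn_planeLaplacian isOpen_univ))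
          (hgc.of_isClosed_subset (isClosed_tsupport _) (tsupport_planeLaplacian_subset g))
          ((tsupport_planeLaplacian_subset g).trans hgV)).neg.integrableOn
      · exact ((((hu.continuousOn.mono hRV).integrableOn_compact
          (isCompact_closedBall 0 R)).mono_set ball_subset_closedBall).neg).const_mul _
      · have h1 := hu0 z (ball_subset_closedBall hz)
        have h2 := hgL z
        nlinarith
    · intro z hz
      have : planeLaplacian g z = 0 := image_eq_zero_of_notMem_tsupport
        fun h => hz (hgR (tsupport_planeLaplacian_subset g h))
      simp [this]
  rw [integral_mul_planeLaplacian hV hu hg hgc hgV] at hupper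
  have h := hlower.trans hupper
  rw [div_mul_eq_mul_div, le_div_iff₀ (by positivity)] at h
  rw [div_mul_eq_mul_div, div_mul_eq_mul_div, div_le_iff₀ hMpos]
  linarith
end
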